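/- arXiv:1409.5017 — 2 statements merged into one kernel-verified Lean document; each statement's English description precedes it below -/
import Mathlib

section
/- Let a_1,…,a_n be positive integers and let A be the n×n 'loop' matrix with A_{ii} = a_i, A_{i,i+1} = 1 for 1 ≤ i ≤ n−1, A_{n,1} = 1, and all other entries 0 (so W_A = x_1^{a_1}x_2 + x_2^{a_2}x_3 + … + x_n^{a_n}x_1); assume det A ≠ 0. Let β ∈ ℤ^n and suppose (βA^{-1})_i ∉ ℤ for some index i. Then (βA^{-1})_j ∉ ℤ for every index j, 1 ≤ j ≤ n. -/
open scoped BigOperators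
open Matrix

/-- The `n × n` "loop" matrix with diagonal `a_1, …, a_n`, `1`s on the superdiagonal and a
`1` in the lower-left corner, corresponding to
`W_A = x_1^{a_1}x_2 + … + x_{n-1}^{a_{n-1}}x_n + x_n^{a_n}x_1`. -/
noncomputable def loopMatrix (n : ℕ) (a : Fin n → ℕ) : Matrix (Fin n) (Fin n) ℚ :=
  fun i j => if j = i then (a i : ℚ) else if (j : ℕ) = ((i : ℕ) + 1) % n then 1 else 0

/-- A rational number is integral if it is in the range of `ℤ → ℚ`. -/
def IsIntegral' (q : ℚ) : Prop := ∃ z : ℤ, q = z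

/-- If `xA = β` with `β` integral, then integrality of an entry of `x` passes to the cyclically
preceding entry. -/
lemma isIntegral'_of_succ {n : ℕ} {a : Fin n → ℕ} {x : Fin n → ℚ} {β : Fin n → ℤ}
    (hx : Matrix.vecMul x (loopMatrix n a) = fun k => (β k : ℚ)) {i j : Fin n}
    (hij : (j : ℕ) = ((i : ℕ) + 1) % n) (hj : IsIntegral' (x j)) : IsIntegral' (x i) := by
  by_cases hne : i = j
  · exact hne ▸ hj
  have hsum : x j * a j + x i = β j := by
    rw [← congrFun hx j]
    simp only [Matrix.vecMul, dotProduct]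
    rw [← Finset.sum_subset (Finset.subset_univ {j, i}), Finset.sum_pair (Ne.symm hne)]
    · simp [loopMatrix, Ne.symm hne, ← hij]
    · intro m _ hm
      simp only [Finset.mem_insert, Finset.mem_singleton, not_or] at hm
      have hmi : (j : ℕ) ≠ ((m : ℕ) + 1) % n := by
        intro h
        have hmod : (m : ℕ) ≡ i [MOD n] := Nat.ModEq.add_right_cancel' 1 (h.symm.trans hij)
        exact hm.2 (Fin.ext (hmod.eq_of_lt_of_lt m.isLt i.isLt))
      simp [loopMatrix, Ne.symm hm.1, hmi]
  obtain ⟨z, hz⟩ := hj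
  refine ⟨β j - z * a j, ?_⟩
  push_cast
  rw [← hsum, hz]
  ring

/-- If `xA = β` with `β` integral, then integrality of one entry of `x` implies integrality of
every entry. -/
lemma isIntegral'_of_isIntegral' {n : ℕ} {a : Fin n → ℕ} {x : Fin n → ℚ} {β : Fin n → ℤ}
    (hx : Matrix.vecMul x (loopMatrix n a) = fun k => (β k : ℚ)) (i j : Fin n)
    (hj : IsIntegral' (x j)) : IsIntegral' (x i) := by
  have hshift : ∀ (m : ℕ) (i : Fin n), (j : ℕ) = ((i : ℕ) + m) % n → IsIntegral' (x i) := by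
    intro m
    induction m with
    | zero =>
      intro i h
      rw [add_zero, Nat.mod_eq_of_lt i.isLt] at h
      exact Fin.ext h ▸ hj
    | succ m ih =>
      intro i h
      refine isIntegral'_of_succ hx (j := ⟨((i : ℕ) + 1) % n, Nat.mod_lt _ i.pos⟩) rfl (ih _ ?_)
      rw [h, Nat.mod_add_mod, add_assoc, add_comm 1 m]
  refine hshift (j + (n - i)) i ?_
  rw [show (i : ℕ) + (j + (n - i)) = j + n by omega, Nat.add_mod_right, Nat.mod_eq_of_lt j.isLt]

/-- For a loop matrix `A` with `det A ≠ 0`, if `(βA⁻¹)_i ∉ ℤ` for some `i`, then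
`(βA⁻¹)_j ∉ ℤ` for every `j`. -/
theorem loop_nonintegral (n : ℕ) (a : Fin n → ℕ) (ha : ∀ i, 0 < a i)
    (hdet : (loopMatrix n a).det ≠ 0)
    (β : Fin n → ℤ) (i : Fin n)
    (hi : ¬ IsIntegral' (Matrix.vecMul (fun k => (β k : ℚ)) (loopMatrix n a)⁻¹ i)) :
    ∀ j : Fin n,
      ¬ IsIntegral' (Matrix.vecMul (fun k => (β k : ℚ)) (loopMatrix n a)⁻¹ j) := by
  intro j hj
  refine hi (isIntegral'_of_isIntegral' (a := a) (β := β) ?_ i j hj)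
  rw [Matrix.vecMul_vecMul, Matrix.nonsing_inv_mul _ (isUnit_iff_ne_zero.mpr hdet),
    Matrix.vecMul_one]
end

section
/- For every 1 ≤ i ≤ n, the operator identities *^A ∘ E_{A,i} = e_i^∨ ∘ *^A and *^A ∘ E_{A,i}^∨ = e_i ∘ *^A hold as linear endomorphisms of ⋀(F^n). -/
open scoped BigOperators
open Matrix

/-- The model for the exterior algebra `⋀(Fⁿ)`: the free `F`-module on the set of
standard basis monomials `e_S = e_{s_1} ∧ … ∧ e_{s_k}`, `s_1 < … < s_k`,
indexed by finite subsets `S`. -/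
abbrev ExtV (F : Type) (ι : Type) := Finset ι → F

/-- Exterior multiplication by `e_i` on `⋀(Fⁿ)`. -/
noncomputable def mulE (F : Type) [Field F] {ι : Type} [LinearOrder ι] (i : ι) :
    ExtV F ι →ₗ[F] ExtV F ι where
  toFun f S := if i ∈ S then (-1 : F) ^ (S.filter (· < i)).card * f (S.erase i) else 0
  map_add' f g := by
    funext S
    by_cases h : i ∈ S <;> simp [h, mul_add]
  map_smul' a f := by
    funext S
    by_cases h : i ∈ S <;> simp [h, mul_left_comm]

/-- Contraction `e_i^∨` on `⋀(Fⁿ)`. -/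
noncomputable def contrE (F : Type) [Field F] {ι : Type} [LinearOrder ι] (i : ι) :
    ExtV F ι →ₗ[F] ExtV F ι where
  toFun f S := if i ∈ S then 0 else (-1 : F) ^ (S.filter (· < i)).card * f (insert i S)
  map_add' f g := by
    funext S
    by_cases h : i ∈ S <;> simp [h, mul_add]
  map_smul' a f := by
    funext S
    by_cases h : i ∈ S <;> simp [h, mul_left_comm]

/-- `E_{A,i} = π ∑_j A_{ij} e_j`. -/
noncomputable def EA (F : Type) [Field F] {ι : Type} [Fintype ι] [LinearOrder ι]
    (π : F) (A : Matrix ι ι ℕ) (i : ι) : ExtV F ι →ₗ[F] ExtV F ι :=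
  π • ∑ j, (A i j : F) • mulE F j

/-- `E^∨_{A,i} = π⁻¹ ∑_j (A⁻¹)_{ji} e_j^∨`, the inverse matrix being computed over `F`. -/
noncomputable def EAdual (F : Type) [Field F] {ι : Type} [Fintype ι] [LinearOrder ι]
    (π : F) (A : Matrix ι ι ℕ) (i : ι) : ExtV F ι →ₗ[F] ExtV F ι :=
  π⁻¹ • ∑ j, ((A.map ((↑) : ℕ → F))⁻¹ j i) • contrE F j

/-- The element `E_{Aᵀ,1} E_{Aᵀ,2} ⋯ E_{Aᵀ,n} (1) ∈ ⋀(Fⁿ)`. -/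
noncomputable def starTop (F : Type) [Field F] {ι : Type} [Fintype ι] [LinearOrder ι]
    (π : F) (A : Matrix ι ι ℕ) : ExtV F ι :=
  (Finset.univ.sort (· ≤ ·)).foldr (fun i v => EA F π Aᵀ i v)
    (Pi.single (∅ : Finset ι) (1 : F))

/-- Borisov's duality operator `*^A`, defined on the standard basis by
`*^A(e_{i_1} ∧ … ∧ e_{i_k}) = E^∨_{Aᵀ,i_1} ⋯ E^∨_{Aᵀ,i_k}(E_{Aᵀ,1} ⋯ E_{Aᵀ,n}(1))`
for `i_1 < … < i_k`. -/
noncomputable def starA (F : Type) [Field F] {ι : Type} [Fintype ι] [LinearOrder ι]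
    (π : F) (A : Matrix ι ι ℕ) : ExtV F ι →ₗ[F] ExtV F ι :=
  (Pi.basisFun F (Finset ι)).constr F fun S =>
    (S.sort (· ≤ ·)).foldr (fun i v => EAdual F π Aᵀ i v) (starTop F π A)

section Anticommuting

variable {F R κ : Type*} [CommRing F] [Ring R] [Algebra F R]

theorem sum_smul_mul_add_mul_sum_smul [Fintype κ] (e f : κ → R) (a b : κ → F) (c : κ → κ → R)
    (h : ∀ i j, e i * f j + f j * e i = c i j) :
    (∑ i, a i • e i) * (∑ j, b j • f j) + (∑ j, b j • f j) * (∑ i, a i • e i) =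
      ∑ i, ∑ j, (a i * b j) • c i j := by
  rw [Finset.sum_mul_sum, Finset.sum_mul_sum, Finset.sum_comm (s := Finset.univ) (t := Finset.univ)
    (f := fun j i => (b j • f j) * (a i • e i)), ← Finset.sum_add_distrib]
  refine Finset.sum_congr rfl fun i _ => ?_
  rw [← Finset.sum_add_distrib]
  refine Finset.sum_congr rfl fun j _ => ?_
  rw [← h, smul_mul_smul_comm, smul_mul_smul_comm, mul_comm (b j), smul_add]

theorem sum_smul_mul_self_eq_zero (e : κ → R) (a : κ → F) (s : Finset κ)
    (h : ∀ i j, e i * e j + e j * e i = 0) (h0 : ∀ i, e i * e i = 0) :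
    (∑ i ∈ s, a i • e i) * (∑ i ∈ s, a i • e i) = 0 := by
  classical
  induction s using Finset.induction_on with
  | empty => simp
  | insert k s hk ih =>
    have hc : (a k • e k) * (∑ i ∈ s, a i • e i) + (∑ i ∈ s, a i • e i) * (a k • e k) = 0 := by
      rw [Finset.mul_sum, Finset.sum_mul, ← Finset.sum_add_distrib]
      refine Finset.sum_eq_zero fun i _ => ?_
      rw [smul_mul_smul_comm, smul_mul_smul_comm, mul_comm (a i), ← smul_add, h, smul_zero]
    rw [Finset.sum_insert hk, add_mul, mul_add, mul_add, ih, add_zero, add_assoc, hc,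
      smul_mul_smul_comm, h0, smul_zero, add_zero]

end Anticommuting

section Clifford

variable {F : Type} [Field F] {ι : Type} [LinearOrder ι]

theorem neg_one_pow_card_filter_insert {i : ι} {S : Finset ι} (hi : i ∉ S) (j : ι) :
    (-1 : F) ^ ((insert i S).filter (· < j)).card =
      (if i < j then -1 else 1) * (-1 : F) ^ (S.filter (· < j)).card := by
  rw [Finset.filter_insert]
  split_ifs with h
  · rw [Finset.card_insert_of_notMem (by simp [hi]), pow_succ, mul_comm]
  · rw [one_mul]

theorem neg_one_pow_card_filter_erase {i : ι} {S : Finset ι} (hi : i ∈ S) (j : ι) :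
    (-1 : F) ^ ((S.erase i).filter (· < j)).card =
      (if i < j then -1 else 1) * (-1 : F) ^ (S.filter (· < j)).card := by
  conv_rhs => rw [← Finset.insert_erase hi, neg_one_pow_card_filter_insert (by simp)]
  split_ifs <;> simp

theorem mulE_apply (i : ι) (f : ExtV F ι) (S : Finset ι) :
    mulE F i f S = if i ∈ S then (-1 : F) ^ (S.filter (· < i)).card * f (S.erase i) else 0 :=
  rfl

theorem contrE_apply (i : ι) (f : ExtV F ι) (S : Finset ι) :
    contrE F i f S = if i ∈ S then 0 else (-1 : F) ^ (S.filter (· < i)).card * f (insert i S) :=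
  rfl

theorem mulE_mul_self (i : ι) : mulE F i * mulE F i = 0 := by
  ext1 f; funext S
  simp [mulE_apply]

theorem contrE_mul_self (i : ι) : contrE F i * contrE F i = 0 := by
  refine LinearMap.ext fun f => funext fun S => ?_
  simp [contrE_apply]

theorem mulE_anticomm (i j : ι) : mulE F i * mulE F j + mulE F j * mulE F i = 0 := by
  rcases eq_or_ne i j with rfl | hij
  · simp [mulE_mul_self]
  refine LinearMap.ext fun f => funext fun S => ?_
  by_cases hi : i ∈ S <;> by_cases hj : j ∈ S <;>
    simp [mulE_apply, hi, hj, hij, hij.symm, neg_one_pow_card_filter_erase,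
      Finset.erase_right_comm (a := j) (b := i)]
  rcases lt_or_gt_of_ne hij with h | h <;> simp [h, h.not_gt] <;> ring

theorem contrE_anticomm (i j : ι) : contrE F i * contrE F j + contrE F j * contrE F i = 0 := by
  rcases eq_or_ne i j with rfl | hij
  · simp [contrE_mul_self]
  refine LinearMap.ext fun f => funext fun S => ?_
  by_cases hi : i ∈ S <;> by_cases hj : j ∈ S <;>
    simp [contrE_apply, hi, hj, hij, hij.symm, neg_one_pow_card_filter_insert,
      Finset.insert_comm j i]
  rcases lt_or_gt_of_ne hij with h | h <;> simp [h, h.not_gt] <;> ring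

theorem mulE_contrE_anticomm (i j : ι) :
    mulE F i * contrE F j + contrE F j * mulE F i = if i = j then 1 else 0 := by
  refine LinearMap.ext fun f => funext fun S => ?_
  rcases eq_or_ne i j with rfl | hij
  · by_cases hi : i ∈ S <;>
      simp [mulE_apply, contrE_apply, hi, neg_one_pow_card_filter_insert,
        neg_one_pow_card_filter_erase, ← mul_assoc, ← pow_add, ← two_mul]
  · by_cases hi : i ∈ S <;> by_cases hj : j ∈ S <;>
      simp [mulE_apply, contrE_apply, hi, hj, hij, hij.symm, neg_one_pow_card_filter_insert,
        neg_one_pow_card_filter_erase, Finset.erase_insert_of_ne hij.symm]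
    rcases lt_or_gt_of_ne hij with h | h <;> simp [h, h.not_gt] <;> ring

theorem mulE_single_of_notMem {i : ι} {S : Finset ι} (hi : i ∉ S) :
    mulE F i (Pi.single S 1) =
      (-1 : F) ^ (S.filter (· < i)).card • Pi.single (insert i S) (1 : F) := by
  funext U
  by_cases hU : U = insert i S
  · subst hU
    simp [mulE_apply, hi, neg_one_pow_card_filter_insert]
  · have : i ∈ U → U.erase i ≠ S := by
      rintro h rfl
      exact hU (Finset.insert_erase h).symm
    by_cases h : i ∈ U <;> simp [mulE_apply, h, hU, this]

theorem mulE_single_of_mem {i : ι} {S : Finset ι} (hi : i ∈ S) :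
    mulE F i (Pi.single S 1) = 0 := by
  funext U
  have : U.erase i ≠ S := by
    rintro rfl
    simp at hi
  simp [mulE_apply, this]

theorem mulE_single_of_forall_lt {i : ι} {S : Finset ι} (hi : ∀ x ∈ S, i < x) :
    mulE F i (Pi.single S 1) = Pi.single (insert i S) (1 : F) := by
  rw [mulE_single_of_notMem fun h => lt_irrefl i (hi i h),
    Finset.filter_false_of_mem fun x hx => (hi x hx).not_gt]
  simp

theorem contrE_single_empty (i : ι) : contrE F i (Pi.single ∅ 1) = 0 := by
  funext U
  simp [contrE_apply]

variable [Fintype ι] (π : F) (A : Matrix ι ι ℕ)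

theorem EA_mul_self (i : ι) : EA F π A i * EA F π A i = 0 := by
  rw [EA, smul_mul_smul_comm, sum_smul_mul_self_eq_zero (mulE F) (fun j => (A i j : F)) _
      mulE_anticomm mulE_mul_self,
    smul_zero]

theorem EA_anticomm (i j : ι) : EA F π A i * EA F π A j + EA F π A j * EA F π A i = 0 := by
  rw [EA, EA, smul_mul_smul_comm, smul_mul_smul_comm, ← smul_add,
    sum_smul_mul_add_mul_sum_smul (mulE F) (mulE F) (fun k => (A i k : F))
      (fun k => (A j k : F)) _ mulE_anticomm]
  simp

theorem EAdual_mul_self (i : ι) : EAdual F π A i * EAdual F π A i = 0 := by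
  rw [EAdual, smul_mul_smul_comm,
    sum_smul_mul_self_eq_zero (contrE F) (fun j => (A.map ((↑) : ℕ → F))⁻¹ j i) _
      contrE_anticomm contrE_mul_self, smul_zero]

theorem EAdual_anticomm (i j : ι) :
    EAdual F π A i * EAdual F π A j + EAdual F π A j * EAdual F π A i = 0 := by
  rw [EAdual, EAdual, smul_mul_smul_comm, smul_mul_smul_comm, ← smul_add,
    sum_smul_mul_add_mul_sum_smul (contrE F) (contrE F) (fun k => (A.map ((↑) : ℕ → F))⁻¹ k i)
      (fun k => (A.map ((↑) : ℕ → F))⁻¹ k j) _ contrE_anticomm]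
  simp

variable {π A}

theorem EA_EAdual_anticomm (hπ : π ≠ 0) (hdet : IsUnit (A.map ((↑) : ℕ → F)).det) (i j : ι) :
    EA F π A i * EAdual F π A j + EAdual F π A j * EA F π A i = if i = j then 1 else 0 := by
  have key : ∑ k, (A i k : F) * (A.map ((↑) : ℕ → F))⁻¹ k j = if i = j then 1 else 0 := by
    have := congrFun₂ (Matrix.mul_nonsing_inv _ hdet) i j
    rwa [Matrix.mul_apply, Matrix.one_apply] at this
  rw [EA, EAdual, smul_mul_smul_comm, smul_mul_smul_comm, mul_inv_cancel₀ hπ, inv_mul_cancel₀ hπ,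
    one_smul, one_smul, sum_smul_mul_add_mul_sum_smul (mulE F) (contrE F) (fun k => (A i k : F))
      (fun k => (A.map ((↑) : ℕ → F))⁻¹ k j) _ mulE_contrE_anticomm]
  simp only [smul_ite, smul_zero, Finset.sum_ite_eq, Finset.mem_univ, if_true]
  rw [← Finset.sum_smul, key]
  split_ifs <;> simp

variable (π A)

theorem EA_foldr_eq_zero_of_mem {i : ι} (v : ExtV F ι) {l : List ι} (hi : i ∈ l) :
    EA F π A i (l.foldr (fun j w => EA F π A j w) v) = 0 := by
  induction l with
  | nil => simp at hi
  | cons a l ih =>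
    rw [List.foldr_cons]
    rcases List.mem_cons.1 hi with rfl | h
    · exact LinearMap.congr_fun (EA_mul_self π A i) _
    · have := LinearMap.congr_fun (EA_anticomm π A i a)
        (l.foldr (fun j w => EA F π A j w) v)
      simpa [ih h] using this

theorem EA_transpose_starTop (i : ι) : EA F π Aᵀ i (starTop F π A) = 0 :=
  EA_foldr_eq_zero_of_mem π Aᵀ _ (by simp)

theorem starA_single (S : Finset ι) :
    starA F π A (Pi.single S 1) =
      (S.sort (· ≤ ·)).foldr (fun i v => EAdual F π Aᵀ i v) (starTop F π A) := by
  rw [← Pi.basisFun_apply, starA, Module.Basis.constr_basis]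

theorem starA_single_insert {a : ι} {S : Finset ι} (ha : ∀ x ∈ S, a < x) :
    starA F π A (Pi.single (insert a S) 1) = EAdual F π Aᵀ a (starA F π A (Pi.single S 1)) := by
  rw [starA_single, starA_single, Finset.sort_insert _ (fun x hx => (ha x hx).le)
    (fun h => lt_irrefl a (ha a h)), List.foldr_cons]

theorem starA_mulE_single (i : ι) (S : Finset ι) :
    starA F π A (mulE F i (Pi.single S 1)) = EAdual F π Aᵀ i (starA F π A (Pi.single S 1)) := by
  induction S using Finset.induction_on_min with
  | empty => rw [mulE_single_of_forall_lt (by simp), starA_single_insert π A (by simp)]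
  | insert a S ha ih =>
    rcases lt_trichotomy i a with hia | rfl | hai
    · have hi : ∀ x ∈ insert a S, i < x := by
        intro x hx
        rcases Finset.mem_insert.1 hx with rfl | hx
        · exact hia
        · exact hia.trans (ha x hx)
      rw [mulE_single_of_forall_lt hi, starA_single_insert π A hi]
    · rw [mulE_single_of_mem (Finset.mem_insert_self _ _), starA_single_insert π A ha, map_zero]
      exact (LinearMap.congr_fun (EAdual_mul_self π Aᵀ i) _).symm
    · have hmul : starA F π A (mulE F a (mulE F i (Pi.single S 1))) =
          EAdual F π Aᵀ a (starA F π A (mulE F i (Pi.single S 1))) := by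
        by_cases hi : i ∈ S
        · simp [mulE_single_of_mem hi]
        · have ha' : ∀ x ∈ insert i S, a < x := by
            intro x hx
            rcases Finset.mem_insert.1 hx with rfl | hx
            · exact hai
            · exact ha x hx
          rw [mulE_single_of_notMem hi, map_smul, map_smul, map_smul, map_smul,
            mulE_single_of_forall_lt ha', starA_single_insert π A ha']
      have h1 := LinearMap.congr_fun (mulE_anticomm (F := F) i a) (Pi.single S 1)
      have h2 := LinearMap.congr_fun (EAdual_anticomm π Aᵀ i a) (starA F π A (Pi.single S 1))
      simp only [LinearMap.add_apply, Module.End.mul_apply, LinearMap.zero_apply] at h1 h2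
      rw [starA_single_insert π A ha, ← mulE_single_of_forall_lt ha, eq_neg_of_add_eq_zero_left h1,
        eq_neg_of_add_eq_zero_left h2, map_neg, hmul, ih]

theorem starA_mul_mulE (i : ι) :
    starA F π A * mulE F i = EAdual F π Aᵀ i * starA F π A :=
  (Pi.basisFun F (Finset ι)).ext fun S => by
    simpa using starA_mulE_single π A i S

variable {π A}

theorem starA_mul_contrE (hπ : π ≠ 0) (hdet : IsUnit (A.map ((↑) : ℕ → F)).det) (i : ι) :
    starA F π A * contrE F i = EA F π Aᵀ i * starA F π A := by
  have hdet' : IsUnit (Aᵀ.map ((↑) : ℕ → F)).det := by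
    rwa [Matrix.transpose_map, Matrix.det_transpose]
  refine (Pi.basisFun F (Finset ι)).ext fun S => ?_
  rw [Pi.basisFun_apply, Module.End.mul_apply, Module.End.mul_apply]
  induction S using Finset.induction_on_min with
  | empty => rw [contrE_single_empty, map_zero, starA_single, Finset.sort_empty, List.foldr_nil,
      EA_transpose_starTop]
  | insert a S ha ih =>
    have h1 := LinearMap.congr_fun (mulE_contrE_anticomm (F := F) a i) (Pi.single S 1)
    have h2 := LinearMap.congr_fun (EA_EAdual_anticomm hπ hdet' i a) (starA F π A (Pi.single S 1))
    have h3 := LinearMap.congr_fun (starA_mul_mulE π A a) (contrE F i (Pi.single S 1))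
    simp only [LinearMap.add_apply, Module.End.mul_apply] at h1 h2 h3
    rw [starA_single_insert π A ha, ← mulE_single_of_forall_lt ha, eq_sub_of_add_eq' h1,
      eq_sub_of_add_eq h2, map_sub, h3, ih]
    congr 1
    by_cases h : a = i
    · simp [h]
    · simp [h, Ne.symm h]

theorem sum_smul_EAdual_transpose (hπ : π ≠ 0) (hdet : IsUnit (A.map ((↑) : ℕ → F)).det) (i : ι) :
    π • ∑ j, (A i j : F) • EAdual F π Aᵀ j = contrE F i := by
  have key (k : ι) : ∑ j, (A i j : F) * (Aᵀ.map ((↑) : ℕ → F))⁻¹ k j = if i = k then 1 else 0 := by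
    have := congrFun₂ (Matrix.mul_nonsing_inv _ hdet) i k
    rw [Matrix.mul_apply, Matrix.one_apply] at this
    rw [← this, Matrix.transpose_map, ← Matrix.transpose_nonsing_inv]
    rfl
  simp only [EAdual, Finset.smul_sum, smul_smul]
  rw [Finset.sum_comm]
  simp [← Finset.sum_smul, mul_left_comm _ π⁻¹, inv_mul_cancel_left₀ hπ, key]

theorem sum_smul_EA_transpose (hπ : π ≠ 0) (hdet : IsUnit (A.map ((↑) : ℕ → F)).det) (i : ι) :
    π⁻¹ • ∑ j, ((A.map ((↑) : ℕ → F))⁻¹ j i) • EA F π Aᵀ j = mulE F i := by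
  have key (k : ι) : ∑ j, (A.map ((↑) : ℕ → F))⁻¹ j i * (A k j : F) = if k = i then 1 else 0 := by
    have := congrFun₂ (Matrix.mul_nonsing_inv _ hdet) k i
    rw [Matrix.mul_apply, Matrix.one_apply] at this
    rw [← this]
    exact Finset.sum_congr rfl fun j _ => mul_comm _ _
  simp only [EA, Finset.smul_sum, smul_smul, Matrix.transpose_apply]
  rw [Finset.sum_comm]
  simp [← Finset.sum_smul, mul_left_comm _ π, mul_inv_cancel_left₀ hπ, key]

end Clifford

/-- For all `i`, `*^A ∘ E_{A,i} = e_i^∨ ∘ *^A` and `*^A ∘ E^∨_{A,i} = e_i ∘ *^A`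
as linear endomorphisms of `⋀(Fⁿ)`. -/
theorem starA_conjugates (F : Type) [Field F] (n : ℕ) (π : F) (hπ : π ≠ 0)
    (A : Matrix (Fin n) (Fin n) ℕ) (hdet : IsUnit ((A.map ((↑) : ℕ → F)).det)) :
    ∀ i : Fin n,
      (starA F π A).comp (EA F π A i) = (contrE F i).comp (starA F π A) ∧
      (starA F π A).comp (EAdual F π A i) = (mulE F i).comp (starA F π A) := by
  intro i
  constructor
  · rw [← sum_smul_EAdual_transpose hπ hdet i, EA, ← Module.End.mul_eq_comp,
      ← Module.End.mul_eq_comp, mul_smul_comm, smul_mul_assoc, Finset.mul_sum, Finset.sum_mul]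
    simp only [mul_smul_comm, smul_mul_assoc, starA_mul_mulE]
  · rw [← sum_smul_EA_transpose hπ hdet i, EAdual, ← Module.End.mul_eq_comp,
      ← Module.End.mul_eq_comp, mul_smul_comm, smul_mul_assoc, Finset.mul_sum, Finset.sum_mul]
    simp only [mul_smul_comm, smul_mul_assoc, starA_mul_contrE hπ hdet]
end
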